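/- Let n = 2m, q = 2^m > 2, u a generator of μ_{q+1}, a_i ∈ 𝔽_{q²} and l_i nonnegative integers for i = 0,…,q (with f(0) = Tr₁ⁿ(a_∞·0) = 0). Define f : 𝔽_{q²} → 𝔽₂ by f(x) = Tr₁ⁿ(a_i x^{l_i(q−1)}) for x ∈ u^i 𝔽_q^*, and f(0)=0. Then f is bent if and only if Σ_{i=0}^{q} (−1)^{Tr₁ⁿ(a_i u^{−2 i l_i})} = 1. -/

import Mathlib

open scoped Classical

/-- The absolute trace of a field of characteristic 2, as the sum of Frobenius powers. -/
def FTr (F : Type*) [Field F] (k : ℕ) (x : F) : F :=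
  ∑ i ∈ Finset.range k, x ^ 2 ^ i

/-- The additive character sign (-1)^y for y in the prime field {0,1}. -/
noncomputable def chi (F : Type*) [Field F] (y : F) : ℤ :=
  if y = 0 then 1 else -1

theorem charP_two_of_card {F : Type*} [Field F] [Fintype F] {m : ℕ}
    (hF : Fintype.card F = (2 ^ m) ^ 2) : CharP F 2 := by
  obtain ⟨p, hp⟩ := CharP.exists F
  obtain ⟨n, hpr, hn⟩ := FiniteField.card F p
  have h : p ∣ 2 := by
    refine hpr.dvd_of_dvd_pow (n := m * 2) ?_
    rw [pow_mul, ← hF, hn]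
    exact dvd_pow_self p n.ne_zero
  rwa [← (Nat.prime_dvd_prime_iff_eq hpr Nat.prime_two).1 h]

theorem card_sub_one_eq {F : Type*} [Fintype F] {q : ℕ} (hF : Fintype.card F = q ^ 2) :
    Fintype.card F - 1 = (q + 1) * (q - 1) := by
  rw [hF]
  simpa using Nat.sq_sub_sq q 1

theorem ne_zero_of_orderOf_ne_zero {F : Type*} [Field F] {u : F} (hu : orderOf u ≠ 0) : u ≠ 0 := by
  rintro rfl
  exact hu (by simp)

theorem FTr_add {F : Type*} [Field F] [CharP F 2] (k : ℕ) (x y : F) :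
    FTr F k (x + y) = FTr F k x + FTr F k y := by
  simp only [FTr, ← Finset.sum_add_distrib]
  exact Finset.sum_congr rfl fun i _ => add_pow_char_pow x y 2 i

theorem FTr_eq_zero_or_one {F : Type*} [Field F] [CharP F 2] {k : ℕ} {x : F}
    (hx : x ^ 2 ^ k = x) : FTr F k x = 0 ∨ FTr F k x = 1 := by
  have h : FTr F k x ^ 2 = FTr F k x := by
    have h1 : FTr F k x ^ 2 = ∑ i ∈ Finset.range k, x ^ 2 ^ (i + 1) := by
      rw [FTr, sum_pow_char]
      exact Finset.sum_congr rfl fun i _ => by rw [← pow_mul, ← pow_succ]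
    have h2 := Finset.sum_range_succ (fun i => x ^ 2 ^ i) k
    rw [Finset.sum_range_succ', hx] at h2
    rw [h1, FTr]
    simpa using h2
  have h' : FTr F k x * (FTr F k x - 1) = 0 := by linear_combination h
  exact (mul_eq_zero.1 h').imp_right sub_eq_zero.1

theorem FTr_two_mul_eq_zero_or_one {F : Type*} [Field F] [Fintype F] [CharP F 2] {m : ℕ}
    (hF : Fintype.card F = (2 ^ m) ^ 2) (x : F) : FTr F (2 * m) x = 0 ∨ FTr F (2 * m) x = 1 :=
  FTr_eq_zero_or_one <| by rw [mul_comm, pow_mul 2 m, ← hF, FiniteField.pow_card]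

theorem chi_add {F : Type*} [Field F] [CharP F 2] {x y : F} (hx : x = 0 ∨ x = 1)
    (hy : y = 0 ∨ y = 1) : chi F (x + y) = chi F x * chi F y := by
  have h : (1 : F) + 1 = 0 := CharTwo.add_self_eq_zero 1
  rcases hx with rfl | rfl <;> rcases hy with rfl | rfl <;> simp [chi, h]

theorem chi_eq_one_or_neg_one {F : Type*} [Field F] (x : F) : chi F x = 1 ∨ chi F x = -1 := by
  unfold chi
  split_ifs <;> simp

/-- The trace to the prime field factors through the subfield fixed by `x ↦ x ^ 2 ^ m`. -/
theorem FTr_two_mul {F : Type*} [Field F] [CharP F 2] (m : ℕ) (z : F) :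
    FTr F (2 * m) z = FTr F m (z + z ^ 2 ^ m) := by
  rw [FTr_add, two_mul, FTr, Finset.sum_range_add]
  congr 1
  exact Finset.sum_congr rfl fun i _ => by rw [← pow_mul, ← pow_add]

theorem exists_FTr_ne_zero {F : Type*} [Field F] {m : ℕ} (hm : m ≠ 0) {s : Finset F}
    (hs : 2 ^ m ≤ s.card) : ∃ y ∈ s, FTr F m y ≠ 0 := by
  by_contra! h
  let p : Polynomial F := ∑ i ∈ Finset.range m, Polynomial.X ^ 2 ^ i
  have hp : p = 0 := by
    refine Polynomial.eq_zero_of_natDegree_lt_card_of_eval_eq_zero' p s (fun y hy => ?_) ?_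
    · simpa [p, Polynomial.eval_finsetSum, FTr] using h y hy
    · refine lt_of_le_of_lt (Polynomial.natDegree_sum_le_of_forall_le (n := 2 ^ (m - 1)) _ _
        fun i hi => ?_) (lt_of_lt_of_le ?_ hs)
      · rw [Polynomial.natDegree_X_pow]
        exact Nat.pow_le_pow_right two_pos (by have := Finset.mem_range.1 hi; omega)
      · exact Nat.pow_lt_pow_right one_lt_two (by omega)
  have hc : p.coeff 1 = 1 := by
    rw [Polynomial.finsetSum_coeff, Finset.sum_eq_single 0]
    · simp
    · intro i _ hi
      rw [Polynomial.coeff_X_pow, if_neg]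
      exact (Nat.one_lt_two_pow hi).ne
    · intro h0
      exact absurd (Finset.mem_range.2 (Nat.pos_of_ne_zero hm)) h0
  simp [hp] at hc

theorem sum_chi_FTr_fixed_eq_zero {F : Type*} [Field F] [Fintype F] [CharP F 2] {m : ℕ}
    (hm : m ≠ 0) (hK : 2 ^ m ≤ (Finset.univ.filter fun y : F => y ^ 2 ^ m = y).card)
    {w : F} (hw : w ≠ 0) (hwK : w ^ 2 ^ m = w) :
    ∑ y : F with y ^ 2 ^ m = y, chi F (FTr F m (w * y)) = 0 := by
  obtain ⟨y₀, hy₀, hne⟩ := exists_FTr_ne_zero hm hK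
  have hy₀' : y₀ ^ 2 ^ m = y₀ := by simpa using hy₀
  have key : ∑ y : F with y ^ 2 ^ m = y, chi F (FTr F m (w * y)) =
      ∑ y : F with y ^ 2 ^ m = y, -chi F (FTr F m (w * y)) := by
    refine Finset.sum_equiv (Equiv.addRight (y₀ / w)) (fun y => ?_) fun y hy => ?_
    · simp [add_pow_char_pow, div_pow, hy₀', hwK]
    · have hy' : y ^ 2 ^ m = y := by simpa using hy
      have h0 := FTr_eq_zero_or_one hy₀'
      have h1 := FTr_eq_zero_or_one (k := m) (x := w * y) (by rw [mul_pow, hwK, hy'])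
      rw [Equiv.coe_addRight, mul_add, mul_div_cancel₀ _ hw, FTr_add, chi_add h1 h0,
        h0.resolve_left hne]
      simp [chi]
  rw [Finset.sum_neg_distrib] at key
  omega

theorem card_filter_pow_eq_one {F : Type*} [Field F] [Fintype F] {k n : ℕ} (hn : n ≠ 0)
    (h : Fintype.card F - 1 = k * n) :
    (Finset.univ.filter fun y : F => y ^ n = 1).card = n := by
  obtain ⟨g, hg⟩ := IsCyclic.exists_generator (α := Fˣ)
  have hord : orderOf (g : F) = k * n := by
    rw [orderOf_units, orderOf_eq_card_of_forall_mem_zpowers hg, Nat.card_eq_fintype_card,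
      Fintype.card_units, h]
  have hk : k * n ≠ 0 := by
    rw [← h]
    have := Fintype.one_lt_card (α := F)
    omega
  have hprim : IsPrimitiveRoot ((g : F) ^ k) n :=
    (hord ▸ IsPrimitiveRoot.orderOf (g : F)).pow (Nat.pos_of_ne_zero hk) rfl
  refine Eq.trans (congrArg Finset.card ?_) hprim.card_nthRootsFinset
  ext y
  simp [Polynomial.mem_nthRootsFinset (Nat.pos_of_ne_zero hn)]

theorem pow_eq_self_iff {F : Type*} [Field F] {q : ℕ} (hq : q ≠ 0) {y : F} (hy : y ≠ 0) :
    y ^ q = y ↔ y ^ (q - 1) = 1 := by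
  rw [← mul_left_inj' (a := y ^ (q - 1)) hy, ← pow_succ, Nat.sub_add_cancel (by omega), one_mul]

theorem pow_eq_self_iff_or {F : Type*} [Field F] {q : ℕ} (hq : 2 ≤ q) {y : F} :
    y ^ q = y ↔ y = 0 ∨ y ^ (q - 1) = 1 := by
  by_cases hy : y = 0
  · simp [hy, show q ≠ 0 by omega]
  · simp [hy, pow_eq_self_iff (show q ≠ 0 by omega) hy]

theorem filter_pow_eq_self {F : Type*} [Field F] [Fintype F] {q : ℕ} (hq : 2 ≤ q) :
    (Finset.univ.filter fun y : F => y ^ q = y) =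
      insert 0 (Finset.univ.filter fun y : F => y ^ (q - 1) = 1) := by
  ext y
  simp [pow_eq_self_iff_or hq]

theorem zero_notMem_filter_pow {F : Type*} [Field F] [Fintype F] {q : ℕ} (hq : 2 ≤ q) :
    (0 : F) ∉ Finset.univ.filter fun y : F => y ^ (q - 1) = 1 := by
  simp [show q - 1 ≠ 0 by omega]

/-- The character sum over a multiplicative coset of the subfield of order `2 ^ m`. -/
theorem sum_chi_FTr_coset {F : Type*} [Field F] [Fintype F] [CharP F 2] {m : ℕ} (hm : m ≠ 0)
    (hF : Fintype.card F = (2 ^ m) ^ 2) (z : F) :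
    ∑ y : F with y ^ (2 ^ m - 1) = 1, chi F (FTr F (2 * m) (z * y)) =
      if z ^ 2 ^ m = z then 2 ^ m - 1 else -1 := by
  have hq : 2 ≤ 2 ^ m := Nat.le_self_pow hm 2
  have hcard : (Finset.univ.filter fun y : F => y ^ (2 ^ m - 1) = 1).card = 2 ^ m - 1 :=
    card_filter_pow_eq_one (by omega) (card_sub_one_eq hF)
  have hK := filter_pow_eq_self (F := F) hq
  have h0 := zero_notMem_filter_pow (F := F) hq
  have hTr : ∀ y ∈ Finset.univ.filter (fun y : F => y ^ (2 ^ m - 1) = 1),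
      chi F (FTr F (2 * m) (z * y)) = chi F (FTr F m ((z + z ^ 2 ^ m) * y)) := by
    intro y hy
    have hy' : y ^ 2 ^ m = y := (pow_eq_self_iff_or hq).2 (Or.inr (by simpa using hy))
    rw [FTr_two_mul, mul_pow, hy', add_mul]
  rw [Finset.sum_congr rfl hTr]
  split_ifs with hz
  · rw [hz, CharTwo.add_self_eq_zero]
    simp [FTr, chi, hcard, Nat.cast_sub (show 1 ≤ 2 ^ m by omega)]
  · have hzz : (z ^ 2 ^ m) ^ 2 ^ m = z := by
      rw [← pow_mul, ← pow_two, ← hF, FiniteField.pow_card]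
    have hw : z + z ^ 2 ^ m ≠ 0 := fun h => hz (CharTwo.add_eq_zero.1 h).symm
    have hwK : (z + z ^ 2 ^ m) ^ 2 ^ m = z + z ^ 2 ^ m := by
      rw [add_pow_char_pow, hzz, add_comm]
    have hs := sum_chi_FTr_fixed_eq_zero hm
      (by rw [hK, Finset.card_insert_of_notMem h0, hcard]; omega) hw hwK
    rw [hK, Finset.sum_insert h0] at hs
    have hone : chi F (FTr F m ((z + z ^ 2 ^ m) * 0)) = 1 := by simp [FTr, chi]
    omega

theorem coset_rep_injective {F : Type*} [Field F] {m : ℕ} (hm : m ≠ 0) {u : F}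
    (hu : orderOf u = 2 ^ m + 1) {i j : Fin (2 ^ m + 1)} {y y' : F}
    (hy : y ^ (2 ^ m - 1) = 1) (hy' : y' ^ (2 ^ m - 1) = 1)
    (h : u ^ (i : ℕ) * y = u ^ (j : ℕ) * y') : i = j ∧ y = y' := by
  have hq : 1 ≤ 2 ^ m := Nat.one_le_two_pow
  have hu1 : u ^ (2 ^ m + 1) = 1 := hu ▸ pow_orderOf_eq_one u
  have hu0 : u ≠ 0 := ne_zero_of_orderOf_ne_zero (by omega)
  have hsq : ∀ k : ℕ, (u ^ k) ^ (2 ^ m - 1) * u ^ (2 * k) = 1 := fun k => by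
    rw [← pow_mul, ← pow_add, show k * (2 ^ m - 1) + 2 * k = (2 ^ m + 1) * k by
      zify [hq]; ring, pow_mul, hu1, one_pow]
  have h1 : (u ^ (i : ℕ)) ^ (2 ^ m - 1) = (u ^ (j : ℕ)) ^ (2 ^ m - 1) := by
    rw [← mul_one ((u ^ (i : ℕ)) ^ (2 ^ m - 1)), ← hy, ← mul_pow, h, mul_pow, hy', mul_one]
  have h2 : u ^ (2 * (i : ℕ)) = u ^ (2 * (j : ℕ)) := by
    have hi := hsq i
    rw [h1, ← hsq j] at hi
    exact mul_left_cancel₀ (pow_ne_zero _ (pow_ne_zero _ hu0)) hi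
  have h3 : 2 * (i : ℕ) ≡ 2 * (j : ℕ) [MOD 2 ^ m + 1] := by
    simpa only [hu] using
      (isOfFinOrder_iff_pow_eq_one.2 ⟨_, Nat.succ_pos _, hu1⟩).pow_eq_pow_iff_modEq.1 h2
  have hcop : Nat.gcd (2 ^ m + 1) 2 = 1 :=
    Nat.Coprime.symm (Nat.coprime_two_left.2 ((Nat.even_pow.2 ⟨even_two, hm⟩).add_one))
  have hij : i = j := Fin.ext <| by
    have := Nat.ModEq.cancel_left_of_coprime hcop h3
    rwa [Nat.ModEq, Nat.mod_eq_of_lt i.2, Nat.mod_eq_of_lt j.2] at this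
  subst hij
  exact ⟨rfl, mul_left_cancel₀ (pow_ne_zero _ hu0) h⟩

theorem image_coset_rep {F : Type*} [Field F] [Fintype F] {m : ℕ} (hm : m ≠ 0)
    (hF : Fintype.card F = (2 ^ m) ^ 2) {u : F} (hu : orderOf u = 2 ^ m + 1) :
    ((Finset.univ : Finset (Fin (2 ^ m + 1))) ×ˢ
      (Finset.univ.filter fun y : F => y ^ (2 ^ m - 1) = 1)).image
        (fun p => u ^ (p.1 : ℕ) * p.2) = Finset.univ.erase 0 := by
  have hq : 2 ≤ 2 ^ m := Nat.le_self_pow hm 2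
  have hu0 : u ≠ 0 := ne_zero_of_orderOf_ne_zero (by omega)
  refine Finset.eq_of_subset_of_card_le (fun x hx => ?_) ?_
  · obtain ⟨⟨i, y⟩, hp, rfl⟩ := Finset.mem_image.1 hx
    have hy : y ^ (2 ^ m - 1) = 1 := by simpa using hp
    have hy0 : y ≠ 0 := by
      rintro rfl
      exact zero_notMem_filter_pow (F := F) hq (by simpa using hy)
    simp [hu0, hy0]
  · rw [Finset.card_image_of_injOn, Finset.card_product, Finset.card_erase_of_mem (by simp),
      Finset.card_univ, card_sub_one_eq hF,
      card_filter_pow_eq_one (by omega) (card_sub_one_eq hF)]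
    · simp
    · rintro ⟨i, y⟩ hp ⟨j, y'⟩ hp' h
      have := coset_rep_injective hm hu (by simpa using hp) (by simpa using hp') h
      exact Prod.ext this.1 this.2

theorem sum_eq_sum_cosets {F : Type*} [Field F] [Fintype F] {m : ℕ} (hm : m ≠ 0)
    (hF : Fintype.card F = (2 ^ m) ^ 2) {u : F} (hu : orderOf u = 2 ^ m + 1) (g : F → ℤ) :
    ∑ x : F, g x = g 0 + ∑ i : Fin (2 ^ m + 1),
      ∑ y : F with y ^ (2 ^ m - 1) = 1, g (u ^ (i : ℕ) * y) := by
  rw [← Finset.add_sum_erase _ _ (Finset.mem_univ (0 : F)), ← image_coset_rep hm hF hu,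
    Finset.sum_image, Finset.sum_product]
  rintro ⟨i, y⟩ hp ⟨j, y'⟩ hp' h
  have := coset_rep_injective hm hu (by simpa using hp) (by simpa using hp') h
  exact Prod.ext this.1 this.2

theorem existsUnique_coset_fixed {F : Type*} [Field F] [Fintype F] {m : ℕ} (hm : m ≠ 0)
    (hF : Fintype.card F = (2 ^ m) ^ 2) {u : F} (hu : orderOf u = 2 ^ m + 1)
    {b : F} (hb : b ≠ 0) :
    ∃! i : Fin (2 ^ m + 1), (b * u ^ (i : ℕ)) ^ 2 ^ m = b * u ^ (i : ℕ) := by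
  have hq : 2 ≤ 2 ^ m := Nat.le_self_pow hm 2
  have hmem : b⁻¹ ∈ Finset.univ.erase (0 : F) := by simp [hb]
  rw [← image_coset_rep hm hF hu] at hmem
  obtain ⟨⟨i, y⟩, hp, hiy⟩ := Finset.mem_image.1 hmem
  have hy : y ^ (2 ^ m - 1) = 1 := by simpa using hp
  have hu0 : u ≠ 0 := ne_zero_of_orderOf_ne_zero (by omega)
  dsimp only at hiy
  have hy0 : y ≠ 0 := by
    rintro rfl
    simp [eq_comm, hb] at hiy
  refine ⟨i, ?_, fun j hj => ?_⟩
  · have : b * u ^ (i : ℕ) = y⁻¹ := by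
      rw [← inv_inv b, ← hiy]
      field_simp
    dsimp only
    rw [this, inv_pow, (pow_eq_self_iff_or hq).2 (Or.inr hy)]
  · have hne : b * u ^ (j : ℕ) ≠ 0 := mul_ne_zero hb (pow_ne_zero _ hu0)
    have hj' := (pow_eq_self_iff (by omega) hne).1 hj
    refine (coset_rep_injective hm hu (y := (b * u ^ (j : ℕ))⁻¹) (y' := y) ?_ hy ?_).1
    · rw [inv_pow, hj', inv_one]
    · rw [hiy]
      field_simp

/-- The Walsh transform of a function that is constant on the cosets `u ^ i 𝔽_q^*`. -/
theorem walsh_eq {F : Type*} [Field F] [Fintype F] [CharP F 2] {m : ℕ} (hm : m ≠ 0)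
    (hF : Fintype.card F = (2 ^ m) ^ 2) {u : F} (hu : orderOf u = 2 ^ m + 1)
    {f : F → F} (hf0 : f 0 = 0) {c : Fin (2 ^ m + 1) → F} (hc : ∀ i, c i = 0 ∨ c i = 1)
    (hf : ∀ i : Fin (2 ^ m + 1), ∀ y : F, y ^ (2 ^ m - 1) = 1 → f (u ^ (i : ℕ) * y) = c i)
    (b : F) :
    ∑ x : F, chi F (f x + FTr F (2 * m) (b * x)) =
      1 + ∑ i : Fin (2 ^ m + 1), chi F (c i) *
        (if (b * u ^ (i : ℕ)) ^ 2 ^ m = b * u ^ (i : ℕ) then 2 ^ m - 1 else -1) := by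
  rw [sum_eq_sum_cosets hm hF hu]
  congr 1
  · simp [hf0, FTr, chi]
  · refine Finset.sum_congr rfl fun i _ => ?_
    rw [← sum_chi_FTr_coset hm hF, Finset.mul_sum]
    refine Finset.sum_congr rfl fun y hy => ?_
    rw [hf i y (by simpa using hy), ← mul_assoc b, chi_add (hc i) (FTr_two_mul_eq_zero_or_one hF _)]

/-- Dillon branch functions: f(x) = Tr_1^n(a_i x^{l_i(q-1)}) on the coset u^i F_q^*,
f(0) = 0, is bent iff ∑_i (-1)^{Tr_1^n(a_i u^{-2 i l_i})} = 1. -/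
theorem stmt_14 (m : ℕ) (hm : 2 ≤ m) (F : Type*) [Field F] [Fintype F]
    (hF : Fintype.card F = (2 ^ m) ^ 2)
    (u : F) (hu : orderOf u = 2 ^ m + 1)
    (a : Fin (2 ^ m + 1) → F) (l : Fin (2 ^ m + 1) → ℕ)
    (f : F → F) (hf0 : f 0 = 0)
    (hf : ∀ i : Fin (2 ^ m + 1), ∀ y : F, y ^ (2 ^ m - 1) = 1 →
      f (u ^ (i : ℕ) * y) = FTr F (2 * m) (a i * (u ^ (i : ℕ) * y) ^ (l i * (2 ^ m - 1)))) :
    (∀ b : F, |∑ x : F, chi F (f x + FTr F (2 * m) (b * x))| = (2 ^ m : ℤ)) ↔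
      ∑ i : Fin (2 ^ m + 1),
        chi F (FTr F (2 * m) (a i * (u ^ (2 * (i : ℕ) * l i))⁻¹)) = 1 := by
  have := charP_two_of_card hF
  have hm0 : m ≠ 0 := by omega
  have hq1 : 1 ≤ 2 ^ m := Nat.one_le_two_pow
  have hq4 : (4 : ℤ) ≤ 2 ^ m := by
    exact_mod_cast (Nat.pow_le_pow_right two_pos hm : 2 ^ 2 ≤ 2 ^ m)
  have hu1 : u ^ (2 ^ m + 1) = 1 := hu ▸ pow_orderOf_eq_one u
  set c : Fin (2 ^ m + 1) → F :=
    fun i => FTr F (2 * m) (a i * (u ^ (2 * (i : ℕ) * l i))⁻¹) with hcdef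
  have hc : ∀ i, c i = 0 ∨ c i = 1 := fun i => FTr_two_mul_eq_zero_or_one hF _
  have hfc : ∀ i : Fin (2 ^ m + 1), ∀ y : F, y ^ (2 ^ m - 1) = 1 →
      f (u ^ (i : ℕ) * y) = c i := fun i y hy => by
    rw [hf i y hy, hcdef, mul_pow, mul_comm (l i), pow_mul y, hy, one_pow, mul_one]
    congr 2
    refine eq_inv_of_mul_eq_one_left ?_
    rw [← pow_mul, ← pow_add,
      show (i : ℕ) * ((2 ^ m - 1) * l i) + 2 * i * l i = (2 ^ m + 1) * (i * l i) by
        zify [hq1]; ring, pow_mul, hu1, one_pow]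
  have hW := walsh_eq hm0 hF hu hf0 hc hfc
  simp only [hW]
  change _ ↔ ∑ i, chi F (c i) = 1
  constructor
  · intro h
    have h0 := h 0
    simp only [zero_mul, zero_pow (show 2 ^ m ≠ 0 by omega), if_true, ← Finset.sum_mul] at h0
    generalize ∑ i, chi F (c i) = S at h0 ⊢
    generalize (2 : ℤ) ^ m = q at h0 hq4
    rcases (abs_eq (by omega)).1 h0 with h1 | h1
    · have : (S - 1) * (q - 1) = 0 := by linear_combination h1
      rcases mul_eq_zero.1 this with h2 | h2 <;> omega
    · have hd : (q - 1) * (-S - 1) = 2 := by linear_combination -h1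
      have := Int.le_of_dvd two_pos (Dvd.intro _ hd)
      omega
  · intro hS b
    by_cases hb : b = 0
    · simp [hb, zero_pow (show 2 ^ m ≠ 0 by omega), ← Finset.sum_mul, hS]
    · obtain ⟨i, hi, huniq⟩ := existsUnique_coset_fixed hm0 hF hu hb
      have hsum : ∑ j : Fin (2 ^ m + 1), chi F (c j) *
          (if (b * u ^ (j : ℕ)) ^ 2 ^ m = b * u ^ (j : ℕ) then (2 : ℤ) ^ m - 1 else -1) =
          2 ^ m * chi F (c i) - 1 := by
        have : ∀ j, chi F (c j) *
            (if (b * u ^ (j : ℕ)) ^ 2 ^ m = b * u ^ (j : ℕ) then (2 : ℤ) ^ m - 1 else -1) =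
            (if j = i then 2 ^ m * chi F (c i) else 0) - chi F (c j) := fun j => by
          by_cases hj : j = i
          · subst hj
            rw [if_pos hi, if_pos rfl]
            ring
          · rw [if_neg fun h => hj (huniq j h), if_neg hj]
            ring
        rw [Finset.sum_congr rfl fun j _ => this j, Finset.sum_sub_distrib, hS]
        simp
      rw [hsum, add_sub_cancel, abs_mul, abs_of_nonneg (by positivity)]
      rcases chi_eq_one_or_neg_one (c i) with h | h <;> simp [h]
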